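/- Every uncountable saturated λ-set X ⊆ 2^ω is countable dense homogeneous (as a topological space with the subspace topology). -/

import Mathlib

open Set

/-- The Cantor space `2^ω`. -/
abbrev Cantor : Type := ℕ → Bool

/-- `X ⊆ 2^ω` is a λ-set if every countable subset of `X` is a relative Gδ-set in `X`. -/
def IsLambdaSet (X : Set Cantor) : Prop :=
  ∀ A : Set Cantor, A ⊆ X → A.Countable → ∃ G : Set Cantor, IsGδ G ∧ A = G ∩ X

/-- Tail equivalence on the Cantor space. -/
def TailEquiv (x y : Cantor) : Prop :=
  ∃ m n : ℕ, ∀ k : ℕ, x (m + k) = y (n + k)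

/-- The saturation of a set under tail equivalence. -/
def saturation (X : Set Cantor) : Set Cantor :=
  {y | ∃ x ∈ X, TailEquiv y x}

/-- A set is saturated if it equals its tail-equivalence saturation. -/
def Saturated (X : Set Cantor) : Prop := X = saturation X

/-- A space is countable dense homogeneous (CDH) if for any two countable dense subsets
`D`, `E` there is a homeomorphism of the space mapping `D` onto `E`. -/
def IsCDH (X : Type*) [TopologicalSpace X] : Prop :=
  ∀ D E : Set X, D.Countable → Dense D → E.Countable → Dense E →
    ∃ f : X ≃ₜ X, f '' D = E

/-! ### Length-preserving transducers -/

/-- The state reached by a transducer after reading the first `k` bits of `x`. -/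
def transducerState {σ : Type*} (s₀ : σ) (next : ℕ → σ → Bool → σ) (x : Cantor) : ℕ → σ
  | 0 => s₀
  | k + 1 => next k (transducerState s₀ next x k) (x k)

/-- The output of a transducer that flips the `k`-th bit when `flip` holds in the current state. -/
def transducerRun {σ : Type*} (s₀ : σ) (flip : ℕ → σ → Bool) (next : ℕ → σ → Bool → σ)
    (x : Cantor) : Cantor :=
  fun k => x k ^^ flip k (transducerState s₀ next x k)

/-- The transition function of the transducer undoing `transducerRun s₀ flip next`. -/
def transducerInv {σ : Type*} (flip : ℕ → σ → Bool) (next : ℕ → σ → Bool → σ) :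
    ℕ → σ → Bool → σ :=
  fun k s b => next k s (b ^^ flip k s)

section Transducer

variable {σ : Type*} (s₀ : σ) (flip : ℕ → σ → Bool) (next : ℕ → σ → Bool → σ)

theorem transducerState_isLocallyConstant (k : ℕ) :
    IsLocallyConstant fun x => transducerState s₀ next x k := by
  induction k with
  | zero => exact IsLocallyConstant.const s₀
  | succ k ih =>
    have hk : IsLocallyConstant fun x : Cantor => x k :=
      (IsLocallyConstant.iff_continuous _).2 (continuous_apply k)
    exact (ih.prodMk hk).comp fun p => next k p.1 p.2

theorem continuous_transducerRun : Continuous (transducerRun s₀ flip next) := by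
  refine continuous_pi fun k => ?_
  have hk : IsLocallyConstant fun x : Cantor => x k :=
    (IsLocallyConstant.iff_continuous _).2 (continuous_apply k)
  exact ((hk.prodMk (transducerState_isLocallyConstant s₀ next k)).comp
    fun p => p.1 ^^ flip k p.2).continuous

theorem transducerInv_transducerInv : transducerInv flip (transducerInv flip next) = next := by
  funext k s b
  simp [transducerInv]

theorem transducerState_transducerInv (x : Cantor) (k : ℕ) :
    transducerState s₀ (transducerInv flip next) (transducerRun s₀ flip next x) k =
      transducerState s₀ next x k := by
  induction k with
  | zero => rfl
  | succ k ih => simp [transducerState, ih, transducerInv, transducerRun]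

theorem transducerRun_transducerInv (x : Cantor) :
    transducerRun s₀ flip (transducerInv flip next) (transducerRun s₀ flip next x) = x := by
  funext k
  rw [transducerRun, transducerState_transducerInv]
  simp [transducerRun]

/-- A transducer induces a homeomorphism of the Cantor space. -/
def transducerHomeomorph : Cantor ≃ₜ Cantor where
  toFun := transducerRun s₀ flip next
  invFun := transducerRun s₀ flip (transducerInv flip next)
  left_inv := transducerRun_transducerInv s₀ flip next
  right_inv x := by
    simpa only [transducerInv_transducerInv] using
      transducerRun_transducerInv s₀ flip (transducerInv flip next) x
  continuous_toFun := continuous_transducerRun s₀ flip next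
  continuous_invFun := continuous_transducerRun s₀ flip (transducerInv flip next)

end Transducer

/-! ### Equality modulo finite sets -/

/-- The sequences which differ from some element of `B` at only finitely many places. -/
def finiteModifications (B : Set Cantor) : Set Cantor :=
  {y | ∃ x ∈ B, ∃ n, ∀ k ≥ n, y k = x k}

theorem subset_finiteModifications (B : Set Cantor) : B ⊆ finiteModifications B :=
  fun x hx => ⟨x, hx, 0, fun _ _ => rfl⟩

theorem mem_finiteModifications_of_eventuallyEq {B : Set Cantor} {x y : Cantor} {n : ℕ}
    (h : ∀ k ≥ n, y k = x k) (hx : x ∈ finiteModifications B) : y ∈ finiteModifications B := by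
  obtain ⟨z, hz, m, hm⟩ := hx
  exact ⟨z, hz, max n m, fun k hk =>
    (h k (le_of_max_le_left hk)).trans (hm k (le_of_max_le_right hk))⟩

theorem Set.Countable.finiteModifications {B : Set Cantor} (hB : B.Countable) :
    (finiteModifications B).Countable := by
  refine (hB.biUnion fun x _ =>
    countable_range fun (F : Finset ℕ) (k : ℕ) => if k ∈ F then !x k else x k).mono ?_
  rintro y ⟨x, hx, n, hn⟩
  refine mem_biUnion hx ⟨(Finset.range n).filter fun k => y k ≠ x k, ?_⟩
  funext k
  by_cases hk : y k = x k
  · simp [hk]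
  · have hkn : k < n := lt_of_not_ge fun h => hk (hn k h)
    simp only [Finset.mem_filter, Finset.mem_range, hkn, hk, ne_eq, not_false_eq_true, and_self,
      if_true]
    revert hk
    cases x k <;> cases y k <;> simp

theorem exists_cylinder_subset {U : Set Cantor} (hU : IsOpen U) {x : Cantor} (hx : x ∈ U) :
    ∃ k, ∀ z : Cantor, (∀ i < k, z i = x i) → z ∈ U := by
  obtain ⟨V, ⟨y, k, rfl⟩, hxV, hVU⟩ :=
    (PiNat.isTopologicalBasis_cylinders fun _ : ℕ => Bool).exists_subset_of_mem_open hx hU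
  exact ⟨k, fun z hz => hVU fun i hi => (hz i hi).trans (hxV i hi)⟩

theorem dense_finiteModifications {B : Set Cantor} (hB : B.Nonempty) :
    Dense (finiteModifications B) := by
  rw [dense_iff_inter_open]
  rintro U hU ⟨x, hx⟩
  obtain ⟨b, hb⟩ := hB
  obtain ⟨k, hk⟩ := exists_cylinder_subset hU hx
  refine ⟨fun i => if i < k then x i else b i, hk _ fun i hi => by simp [hi],
    b, hb, k, fun i hi => by simp [not_lt.2 hi]⟩

theorem Saturated.mem_of_eventuallyEq {X : Set Cantor} (hX : Saturated X) {x y : Cantor} {n : ℕ}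
    (h : ∀ k ≥ n, y k = x k) (hx : x ∈ X) : y ∈ X := by
  rw [hX]
  exact ⟨x, hx, n, n, fun k => h _ (Nat.le_add_right n k)⟩

theorem Saturated.finiteModifications_subset {X B : Set Cantor} (hX : Saturated X) (hB : B ⊆ X) :
    finiteModifications B ⊆ X := by
  rintro y ⟨x, hx, n, hn⟩
  exact hX.mem_of_eventuallyEq hn (hB hx)

/-! ### The back-and-forth transducer -/

/-- A state of the back-and-forth transducer: the number of the current stage, the cylinders of the
bits read and of the bits written so far, and possibly a pair of points `(a, b)` such that `a` is
being sent to `b`. -/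
structure SwapState where
  stage : ℕ
  src : Set Cantor
  tgt : Set Cantor
  mode : Option (Cantor × Cantor)

namespace SwapState

/-- The starting state. -/
def start : SwapState := ⟨0, univ, univ, none⟩

/-- While `a` is being sent to `b`, flip the bits where `a` and `b` differ. -/
def flip (k : ℕ) (s : SwapState) : Bool :=
  match s.mode with
  | none => false
  | some p => p.1 k ^^ p.2 k

open Classical in
/-- At stage `n` bits are copied until both cylinders avoid `K n`; then a pair of points is picked,
and the first is sent to the second until the input deviates from the first one. -/
noncomputable def next (K : ℕ → Set Cantor) (pick : ℕ → Set Cantor → Set Cantor → Cantor × Cantor)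
    (k : ℕ) (s : SwapState) (c : Bool) : SwapState :=
  let S := s.src ∩ {z | z k = c}
  let T := s.tgt ∩ {z | z k = (c ^^ s.flip k)}
  match s.mode with
  | none =>
    if Disjoint (S ∪ T) (K s.stage) then ⟨s.stage, S, T, some (pick s.stage S T)⟩
    else ⟨s.stage, S, T, none⟩
  | some p => if c = p.1 k then ⟨s.stage, S, T, some p⟩ else ⟨s.stage + 1, S, T, none⟩

end SwapState

/-- `pick` chooses, inside any two nonempty open sets, points of `A` related by `D` and `E`, giving
priority to the enumeration `e` of `A` on alternating sides. -/
structure IsPick (A D E : Set Cantor) (e : ℕ → Cantor)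
    (pick : ℕ → Set Cantor → Set Cantor → Cantor × Cantor) (n : ℕ) (S T : Set Cantor) : Prop where
  fst_mem : (pick n S T).1 ∈ S
  snd_mem : (pick n S T).2 ∈ T
  fst_mem_A : (pick n S T).1 ∈ A
  snd_mem_A : (pick n S T).2 ∈ A
  mem_iff : (pick n S T).1 ∈ D ↔ (pick n S T).2 ∈ E
  fst_eq : ∀ m, n = 2 * m → e m ∈ S → (pick n S T).1 = e m
  snd_eq : ∀ m, n = 2 * m + 1 → e m ∈ T → (pick n S T).2 = e m

theorem exists_isPick {A D E : Set Cantor} {e : ℕ → Cantor} (he : ∀ m, e m ∈ A)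
    (hDA : D ⊆ A) (hEA : E ⊆ A) (hD : Dense D) (hE : Dense E) (hAD : Dense (A \ D))
    (hAE : Dense (A \ E)) :
    ∃ pick : ℕ → Set Cantor → Set Cantor → Cantor × Cantor, ∀ n S T, IsOpen S → S.Nonempty →
      IsOpen T → T.Nonempty → IsPick A D E e pick n S T := by
  have key : ∀ (n : ℕ) (S T : Set Cantor), ∃ p : Cantor × Cantor, IsOpen S → S.Nonempty →
      IsOpen T → T.Nonempty → p.1 ∈ S ∧ p.2 ∈ T ∧ p.1 ∈ A ∧ p.2 ∈ A ∧ (p.1 ∈ D ↔ p.2 ∈ E) ∧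
      (∀ m, n = 2 * m → e m ∈ S → p.1 = e m) ∧ (∀ m, n = 2 * m + 1 → e m ∈ T → p.2 = e m) := by
    intro n S T
    by_cases h : IsOpen S ∧ S.Nonempty ∧ IsOpen T ∧ T.Nonempty
    swap
    · exact ⟨(e 0, e 0), fun h₁ h₂ h₃ h₄ => (h ⟨h₁, h₂, h₃, h₄⟩).elim⟩
    obtain ⟨hS, hS', hT, hT'⟩ := h
    obtain ⟨d, hdS, hd⟩ := hD.inter_open_nonempty S hS hS'
    obtain ⟨d', hdS', hd'⟩ := hAD.inter_open_nonempty S hS hS'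
    obtain ⟨c, hcT, hc⟩ := hE.inter_open_nonempty T hT hT'
    obtain ⟨c', hcT', hc'⟩ := hAE.inter_open_nonempty T hT hT'
    have hdA := hDA hd
    have hcA := hEA hc
    obtain ⟨m, rfl | rfl⟩ := Nat.even_or_odd' n
    · by_cases hm : e m ∈ S
      · by_cases hmD : e m ∈ D
        · refine ⟨(e m, c), fun _ _ _ _ => ⟨hm, hcT, he m, hcA, by simp [hmD, hc], ?_, ?_⟩⟩
          · intro j hj _; rw [show j = m by omega]
          · intro j hj; omega
        · refine ⟨(e m, c'), fun _ _ _ _ => ⟨hm, hcT', he m, hc'.1, by simp [hmD, hc'.2], ?_, ?_⟩⟩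
          · intro j hj _; rw [show j = m by omega]
          · intro j hj; omega
      · refine ⟨(d, c), fun _ _ _ _ => ⟨hdS, hcT, hdA, hcA, by simp [hd, hc], ?_, ?_⟩⟩
        · intro j hj hjS; exact (hm (by rwa [show m = j by omega])).elim
        · intro j hj; omega
    · by_cases hm : e m ∈ T
      · by_cases hmE : e m ∈ E
        · refine ⟨(d, e m), fun _ _ _ _ => ⟨hdS, hm, hdA, he m, by simp [hmE, hd], ?_, ?_⟩⟩
          · intro j hj; omega
          · intro j hj _; rw [show j = m by omega]
        · refine ⟨(d', e m), fun _ _ _ _ => ⟨hdS', hm, hd'.1, he m, by simp [hmE, hd'.2], ?_, ?_⟩⟩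
          · intro j hj; omega
          · intro j hj _; rw [show j = m by omega]
      · refine ⟨(d, c), fun _ _ _ _ => ⟨hdS, hcT, hdA, hcA, by simp [hd, hc], ?_, ?_⟩⟩
        · intro j hj; omega
        · intro j hj hjT; exact (hm (by rwa [show m = j by omega])).elim
  choose pick hpick using key
  refine ⟨pick, fun n S T h₁ h₂ h₃ h₄ => ?_⟩
  obtain ⟨q₁, q₂, q₃, q₄, q₅, q₆, q₇⟩ := hpick n S T h₁ h₂ h₃ h₄
  exact ⟨q₁, q₂, q₃, q₄, q₅, q₆, q₇⟩

theorem isOpen_cylinder (x : Cantor) (k : ℕ) : IsOpen {z : Cantor | ∀ i < k, z i = x i} :=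
  PiNat.isOpen_cylinder (fun _ : ℕ => Bool) x k

/-- What holds of the state `s` reached after reading `k` bits of `x` and writing `k` bits
of `y`. -/
structure SwapInvariant (A D E : Set Cantor) (e : ℕ → Cantor) (K : ℕ → Set Cantor)
    (x y : Cantor) (k : ℕ) (s : SwapState) : Prop where
  src_eq : s.src = {z | ∀ i < k, z i = x i}
  tgt_eq : s.tgt = {z | ∀ i < k, z i = y i}
  passed : ∀ n < s.stage, x ∉ K n ∧ y ∉ K n ∧ (∀ m, n = 2 * m → e m ≠ x) ∧
    ∀ m, n = 2 * m + 1 → e m ≠ y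
  mode_spec : ∀ p, s.mode = some p → p.1 ∈ s.src ∧ p.2 ∈ s.tgt ∧ p.1 ∈ A ∧ p.2 ∈ A ∧
    (p.1 ∈ D ↔ p.2 ∈ E) ∧ x ∉ K s.stage ∧ y ∉ K s.stage ∧
    (∀ m, s.stage = 2 * m → e m = x → p.1 = x) ∧ ∀ m, s.stage = 2 * m + 1 → e m = y → p.2 = y

theorem SwapInvariant.next {A D E : Set Cantor} {e : ℕ → Cantor} {K : ℕ → Set Cantor}
    {pick : ℕ → Set Cantor → Set Cantor → Cantor × Cantor}
    (hpick : ∀ n S T, IsOpen S → S.Nonempty → IsOpen T → T.Nonempty → IsPick A D E e pick n S T)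
    {x y : Cantor} {k : ℕ} {s : SwapState} (h : SwapInvariant A D E e K x y k s)
    (hy : y k = (x k ^^ s.flip k)) :
    SwapInvariant A D E e K x y (k + 1) (s.next K pick k (x k)) := by
  have hS : s.src ∩ {z | z k = x k} = {z | ∀ i < k + 1, z i = x i} := by
    ext z
    simp only [h.src_eq, mem_inter_iff, mem_ofPred_eq, Nat.forall_lt_succ_right]
  have hT : s.tgt ∩ {z | z k = (x k ^^ s.flip k)} = {z | ∀ i < k + 1, z i = y i} := by
    ext z
    simp only [h.tgt_eq, mem_inter_iff, mem_ofPred_eq, Nat.forall_lt_succ_right, hy]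
  unfold SwapState.next
  simp only [hS, hT]
  set S : Set Cantor := {z | ∀ i < k + 1, z i = x i} with hSdef
  set T : Set Cantor := {z | ∀ i < k + 1, z i = y i} with hTdef
  have hxS : x ∈ S := fun _ _ => rfl
  have hyT : y ∈ T := fun _ _ => rfl
  rcases hmode : s.mode with _ | ⟨a, b⟩
  · simp only
    split_ifs with hK
    · rw [hS, hT] at hK
      refine ⟨rfl, rfl, h.passed, ?_⟩
      rintro p ⟨⟩
      have hp := hpick s.stage S T (isOpen_cylinder x _) ⟨x, hxS⟩ (isOpen_cylinder y _) ⟨y, hyT⟩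
      exact ⟨hp.fst_mem, hp.snd_mem, hp.fst_mem_A, hp.snd_mem_A, hp.mem_iff,
        disjoint_left.1 hK (Or.inl hxS), disjoint_left.1 hK (Or.inr hyT),
        fun m hm hx => (hp.fst_eq m hm (hx ▸ hxS)).trans hx,
        fun m hm hy => (hp.snd_eq m hm (hy ▸ hyT)).trans hy⟩
    · exact ⟨rfl, rfl, h.passed, by simp⟩
  · obtain ⟨ha, hb, haA, hbA, hDE, hxK, hyK, hax, hby⟩ := h.mode_spec _ hmode
    simp only [SwapState.flip, hmode] at hy
    simp only at ha hb haA hbA hDE hax hby ⊢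
    split_ifs with hc
    · refine ⟨rfl, rfl, h.passed, ?_⟩
      rintro p ⟨⟩
      rw [← hc] at hy
      refine ⟨?_, ?_, haA, hbA, hDE, hxK, hyK, hax, hby⟩
      · rw [← hS]; exact ⟨ha, hc.symm⟩
      · rw [← hT]; exact ⟨hb, by simp [SwapState.flip, hmode, ← hc]⟩
    · refine ⟨rfl, rfl, ?_, by simp⟩
      intro n hn
      rcases Nat.lt_succ_iff_lt_or_eq.1 hn with hn | rfl
      · exact h.passed n hn
      · refine ⟨hxK, hyK, fun m hm hx => ?_, fun m hm hyy => ?_⟩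
        · exact hc (congrFun (hax m hm hx) k).symm
        · have := congrFun (hby m hm hyy) k
          rw [hy] at this
          revert hc this
          cases x k <;> cases a k <;> cases b k <;> simp

/-- Let `A` be a countable set invariant under finite modifications, `D` and `E` dense subsets of
`A` with dense relative complements, and `K n` closed sets disjoint from `A`. Then some
homeomorphism of the Cantor space maps `D` to `E`, and maps each point of `A ∪ ⋃ n, K n` within `A`
or to a finite modification of itself; so does its inverse. -/
theorem exists_homeomorph_of_dense {A D E : Set Cantor} {K : ℕ → Set Cantor} (hA : A.Countable)
    (hAfin : finiteModifications A ⊆ A) (hDA : D ⊆ A) (hEA : E ⊆ A) (hD : Dense D) (hE : Dense E)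
    (hAD : Dense (A \ D)) (hAE : Dense (A \ E)) (hK : ∀ n, IsClosed (K n))
    (hKA : ∀ n, Disjoint (K n) A) :
    ∃ h : Cantor ≃ₜ Cantor, ∀ x, (x ∈ D ↔ h x ∈ E) ∧ ((x ∈ A ∧ h x ∈ A) ∨
      (∃ n, ∀ k ≥ n, h x k = x k) ∨ (x ∉ A ∪ ⋃ n, K n) ∧ h x ∉ A ∪ ⋃ n, K n) := by
  obtain ⟨d, hd⟩ := hD.nonempty
  obtain ⟨e, rfl⟩ := hA.exists_eq_range ⟨d, hDA hd⟩
  obtain ⟨pick, hpick⟩ := exists_isPick (fun m => mem_range_self m) hDA hEA hD hE hAD hAE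
  refine ⟨transducerHomeomorph SwapState.start SwapState.flip (SwapState.next K pick), fun x => ?_⟩
  change (x ∈ D ↔ transducerRun SwapState.start SwapState.flip (SwapState.next K pick) x ∈ E) ∧ _
  set y := transducerRun SwapState.start SwapState.flip (SwapState.next K pick) x with hy
  change _ ∧ ((_ ∧ y ∈ _) ∨ (∃ n, ∀ k ≥ n, y k = x k) ∨ _ ∧ y ∉ _)
  set st := transducerState SwapState.start (SwapState.next K pick) x with hst
  have hyk : ∀ k, y k = (x k ^^ (st k).flip k) := fun _ => rfl
  have hsucc : ∀ k, st (k + 1) = (st k).next K pick k (x k) := fun _ => rfl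
  have hinv : ∀ k, SwapInvariant (range e) D E e K x y k (st k) := by
    intro k
    induction k with
    | zero => exact ⟨by simp [hst, transducerState, SwapState.start],
        by simp [hst, transducerState, SwapState.start],
        by simp [hst, transducerState, SwapState.start],
        by simp [hst, transducerState, SwapState.start]⟩
    | succ k ih => exact ih.next hpick (hyk k)
  have hmono : Monotone fun k => (st k).stage := by
    refine monotone_nat_of_le_succ fun k => ?_
    rw [hsucc, SwapState.next]
    rcases (st k).mode with _ | p <;> simp only <;> split_ifs <;> simp
  by_cases hbdd : ∃ k₀, ∀ k ≥ k₀, (st k).stage = (st k₀).stage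
  · obtain ⟨k₀, hk₀⟩ := hbdd
    by_cases hsome : ∃ k₁ ≥ k₀, ∃ p, (st k₁).mode = some p
    · obtain ⟨k₁, hk₁, p, hp⟩ := hsome
      have hmode : ∀ k ≥ k₁, (st k).mode = some p := by
        intro k hk
        induction k, hk using Nat.le_induction with
        | base => exact hp
        | succ k hk ih =>
          have hstage := (hk₀ (k + 1) (by omega)).trans (hk₀ k (by omega)).symm
          rw [hsucc, SwapState.next, ih] at hstage ⊢
          simp only at hstage ⊢
          split_ifs at hstage ⊢ with hc
          · rfl
          · simp at hstage
      have hpx : p.1 = x := by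
        funext i
        have := ((hinv (k₁ + i + 1)).mode_spec p (hmode _ (by omega))).1
        rw [(hinv _).src_eq] at this
        exact this i (by omega)
      have hpy : p.2 = y := by
        funext i
        have := ((hinv (k₁ + i + 1)).mode_spec p (hmode _ (by omega))).2.1
        rw [(hinv _).tgt_eq] at this
        exact this i (by omega)
      obtain ⟨-, -, hxA, hyA, hDE, -⟩ := (hinv k₁).mode_spec p hp
      rw [hpx] at hxA hDE
      rw [hpy] at hyA hDE
      exact ⟨hDE, Or.inl ⟨hxA, hyA⟩⟩
    · have hnone : ∀ k ≥ k₀, (st k).mode = none := fun k hk =>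
        Option.eq_none_iff_forall_ne_some.2 fun p hp => hsome ⟨k, hk, p, hp⟩
      have heq : ∀ k ≥ k₀, y k = x k := fun k hk => by
        simp [hyk, SwapState.flip, hnone k hk]
      have hmem : x ∈ K (st k₀).stage ∨ y ∈ K (st k₀).stage := by
        by_contra! hcon
        obtain ⟨i, hi⟩ := exists_cylinder_subset (hK _).isOpen_compl hcon.1
        obtain ⟨j, hj⟩ := exists_cylinder_subset (hK _).isOpen_compl hcon.2
        set k := k₀ + i + j with hk
        have hn := hnone (k + 1) (by omega)
        have hstage := hk₀ k (by omega)
        have hs := (hinv (k + 1)).src_eq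
        have ht := (hinv (k + 1)).tgt_eq
        rw [hsucc, SwapState.next, hnone k (by omega)] at hn hs ht
        simp only at hn hs ht
        split_ifs at hn hs ht with hdis
        simp only at hs ht
        rw [hs, ht, hstage] at hdis
        refine hdis (disjoint_left.2 ?_)
        rintro z (hz | hz)
        · exact hi z fun l hl => hz l (by omega)
        · exact hj z fun l hl => hz l (by omega)
      have hxy : x ∉ range e ∧ y ∉ range e := by
        have h₁ : y ∈ range e → x ∈ range e := fun h =>
          hAfin ⟨y, h, k₀, fun k hk => (heq k hk).symm⟩
        have h₂ : x ∈ range e → y ∈ range e := fun h => hAfin ⟨x, h, k₀, heq⟩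
        rcases hmem with h | h
        · have := disjoint_left.1 (hKA _) h
          exact ⟨this, fun h => this (h₁ h)⟩
        · have := disjoint_left.1 (hKA _) h
          exact ⟨fun h => this (h₂ h), this⟩
      exact ⟨⟨fun h => (hxy.1 (hDA h)).elim, fun h => (hxy.2 (hEA h)).elim⟩,
        Or.inr (Or.inl ⟨k₀, heq⟩)⟩
  · have hunb : ∀ n, ∃ k, n < (st k).stage := by
      intro n
      induction n with
      | zero =>
        by_contra! hcon
        exact hbdd ⟨0, fun k _ => by have := hcon k; have := hcon 0; omega⟩
      | succ n ih =>
        obtain ⟨k, hk⟩ := ih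
        by_contra! hcon
        exact hbdd ⟨k, fun j hj => by
          have := hcon j; have := hcon k; have : (st k).stage ≤ (st j).stage := hmono hj; omega⟩
    have hpassed : ∀ n, x ∉ K n ∧ y ∉ K n ∧ (∀ m, n = 2 * m → e m ≠ x) ∧
        ∀ m, n = 2 * m + 1 → e m ≠ y := fun n => by
      obtain ⟨k, hk⟩ := hunb n
      exact (hinv k).passed n hk
    have hx : x ∉ range e := fun ⟨m, hm⟩ => (hpassed (2 * m)).2.2.1 m rfl hm
    have hy : y ∉ range e := fun ⟨m, hm⟩ => (hpassed (2 * m + 1)).2.2.2 m rfl hm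
    refine ⟨⟨fun h => (hx (hDA h)).elim, fun h => (hy (hEA h)).elim⟩, Or.inr (Or.inr ⟨?_, ?_⟩)⟩
    · simp only [mem_union, mem_iUnion, not_or, not_exists]
      exact ⟨hx, fun n => (hpassed n).1⟩
    · simp only [mem_union, mem_iUnion, not_or, not_exists]
      exact ⟨hy, fun n => (hpassed n).2.1⟩

/-- Every uncountable saturated λ-set (with the subspace topology) is CDH. -/
theorem CDH_of_saturated_lambda (X : Set Cantor)
    (hunc : ¬ X.Countable) (hsat : Saturated X) (hlam : IsLambdaSet X) :
    IsCDH X := by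
  intro D E hDc hD hEc hE
  have hXne : X.Nonempty := nonempty_iff_ne_empty.2 fun h => hunc (h ▸ countable_empty)
  have hXd : Dense X :=
    (dense_finiteModifications hXne).mono (hsat.finiteModifications_subset Subset.rfl)
  have hdense : ∀ F : Set X, Dense F → Dense (Subtype.val '' F) := fun F hF =>
    hXd.denseRange_val.dense_image continuous_subtype_val hF
  set D' : Set Cantor := Subtype.val '' D with hD'
  set E' : Set Cantor := Subtype.val '' E with hE'
  have hBc : (D' ∪ E').Countable := (hDc.image _).union (hEc.image _)
  have hBX : D' ∪ E' ⊆ X :=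
    union_subset (Subtype.coe_image_subset X D) (Subtype.coe_image_subset X E)
  obtain ⟨p, hpX, hp⟩ : ∃ p ∈ X, p ∉ finiteModifications (D' ∪ E') := by
    by_contra! hcon
    exact hunc (hBc.finiteModifications.mono hcon)
  set A := finiteModifications ((D' ∪ E') ∪ {p}) with hAdef
  have hAc : A.Countable := (hBc.union (countable_singleton p)).finiteModifications
  have hAX : A ⊆ X := hsat.finiteModifications_subset
    (union_subset hBX (singleton_subset_iff.2 hpX))
  have hBA : D' ∪ E' ⊆ A := subset_union_left.trans (subset_finiteModifications _)
  have hcompl : ∀ F ⊆ D' ∪ E', Dense (A \ F) := by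
    intro F hF
    refine (dense_finiteModifications (singleton_nonempty p)).mono ?_
    rintro z ⟨_, rfl, n, hn⟩
    exact ⟨⟨_, Or.inr rfl, n, hn⟩, fun hz => hp ⟨z, hF hz, n, fun k hk => (hn k hk).symm⟩⟩
  obtain ⟨G, hG, hAG⟩ := hlam A hAX hAc
  obtain ⟨U, hU, rfl⟩ := isGδ_iff_eq_iInter_nat.1 hG
  have hcover : X ⊆ A ∪ ⋃ n, (U n)ᶜ := by
    intro x hx
    rw [← compl_iInter]
    by_cases hxU : x ∈ ⋂ n, U n
    · exact Or.inl (hAG ▸ ⟨hxU, hx⟩)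
    · exact Or.inr hxU
  have hdisj : ∀ n, Disjoint (U n)ᶜ A := fun n => by
    rw [disjoint_compl_left_iff_subset, hAG]
    exact inter_subset_left.trans (iInter_subset U n)
  obtain ⟨h, hh⟩ := exists_homeomorph_of_dense (K := fun n => (U n)ᶜ) hAc
    (fun y ⟨_, hx, _, hn⟩ => mem_finiteModifications_of_eventuallyEq hn hx)
    (subset_union_left.trans hBA) (subset_union_right.trans hBA) (hdense D hD) (hdense E hE)
    (hcompl D' subset_union_left) (hcompl E' subset_union_right)
    (fun n => (hU n).isClosed_compl) hdisj
  have hX : ∀ x, x ∈ X ↔ h x ∈ X := by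
    intro x
    rcases (hh x).2 with ⟨h₁, h₂⟩ | ⟨n, hn⟩ | ⟨h₁, h₂⟩
    · exact ⟨fun _ => hAX h₂, fun _ => hAX h₁⟩
    · exact ⟨hsat.mem_of_eventuallyEq hn,
        hsat.mem_of_eventuallyEq fun k hk => (hn k hk).symm⟩
    · exact ⟨fun hx => (h₁ (hcover hx)).elim, fun hx => (h₂ (hcover hx)).elim⟩
  refine ⟨h.subtype hX, ?_⟩
  have hDE : ∀ x : X, x ∈ D ↔ h.subtype hX x ∈ E := by
    intro x
    have := (hh x).1
    rw [hD', hE', Subtype.val_injective.mem_set_image] at this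
    exact this.trans (Subtype.val_injective.mem_set_image (a := h.subtype hX x))
  ext x
  constructor
  · rintro ⟨z, hz, rfl⟩
    exact (hDE z).1 hz
  · intro hx
    refine ⟨(h.subtype hX).symm x, (hDE _).2 ?_, ?_⟩ <;> simp [hx]
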